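/- For every integer n ≥ 0, F_{n+1}(q) = Σ_{j ∈ ℤ} (−1)^j q^{j(5j+1)/2} · [n choose ⌊(n−5j)/2⌋]_q in ℤ[q], where the sum has only finitely many nonzero terms since the q-binomial coefficient vanishes when ⌊(n−5j)/2⌋ < 0 or ⌊(n−5j)/2⌋ > n, and j(5j+1)/2 ≥ 0 for all j ∈ ℤ. -/

import Mathlib

open Polynomial

/-- The Schur q-Fibonacci polynomials: F₀ = 0, F₁ = 1, Fₙ = Fₙ₋₁ + q^(n-2) Fₙ₋₂. -/
noncomputable def qF : ℕ → Polynomial ℤ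
  | 0 => 0
  | 1 => 1
  | n + 2 => qF (n + 1) + X ^ n * qF n
/-- The Gaussian (q-)binomial coefficient [n choose m]_q ∈ ℤ[q], defined via the
Pascal-type recurrence [n+1 choose m]_q = q^m [n choose m]_q + [n choose m-1]_q;
it equals ((1-q^n)⋯(1-q^(n-m+1)))/((1-q^m)⋯(1-q)) for 0 ≤ m ≤ n and is 0 for m > n. -/
noncomputable def qbinom : ℕ → ℕ → Polynomial ℤ
  | _, 0 => 1
  | 0, _ + 1 => 0
  | n + 1, m + 1 => X ^ (m + 1) * qbinom n (m + 1) + qbinom n m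
/-- The q-binomial coefficient with an integer lower index, which is 0 when that index
is negative. -/
noncomputable def qbinomZ (n : ℕ) (m : ℤ) : Polynomial ℤ :=
  if 0 ≤ m then qbinom n m.toNat else 0

theorem qb_zero_right (n : ℕ) : qbinom n 0 = 1 := by cases n <;> simp [qbinom]

theorem qb_ss (n m : ℕ) :
    qbinom (n+1) (m+1) = X ^ (m + 1) * qbinom n (m + 1) + qbinom n m := by rw [qbinom]

theorem qb_gt (n : ℕ) : ∀ m, n < m → qbinom n m = 0 := by
  induction n with
  | zero =>
    intro m h
    obtain ⟨k, rfl⟩ : ∃ k, m = k + 1 := ⟨m - 1, by omega⟩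
    rw [qbinom]
  | succ n ih =>
    intro m h
    obtain ⟨k, rfl⟩ : ∃ k, m = k + 1 := ⟨m - 1, by omega⟩
    rw [qb_ss, ih _ (by omega), ih _ (by omega)]; simp

theorem qb_ss2 (n : ℕ) : ∀ m : ℕ,
    qbinom (n+1) (m+1) = qbinom n (m + 1) + X ^ (n - m) * qbinom n m := by
  induction n with
  | zero =>
    intro m
    rw [qb_ss, qb_gt 0 (m+1) (by omega)]; simp
  | succ n ih =>
    intro m
    rcases Nat.lt_or_ge (n+1) m with h | h
    · rw [qb_gt _ _ (by omega : n + 1 + 1 < m + 1), qb_gt _ _ (by omega : n + 1 < m + 1),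
        qb_gt _ _ h]; simp
    rcases m with _ | m
    · have a := qb_ss n 0
      have b := ih 0
      rw [qb_ss (n+1) 0]
      simp only [qb_zero_right, Nat.sub_zero, mul_one, zero_add, pow_one] at a b ⊢
      linear_combination X * b - a
    · have a1 := qb_ss n (m+1)
      have a2 := qb_ss n m
      have b1 := ih (m+1)
      have b2 := ih m
      rw [qb_ss (n+1) (m+1), show n + 1 - (m+1) = n - m by omega]
      rcases Nat.lt_or_ge n (m+1) with h' | h'
      · rw [qb_gt n (m+1) h', qb_gt n (m+1+1) (by omega)] at *
        linear_combination X ^ (m+2) * b1 + b2 - a1 - X ^ (n-m) * a2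
      · obtain ⟨k, rfl⟩ := Nat.exists_eq_add_of_le h'
        rw [show m + 1 + k - (m + 1) = k by omega] at b1
        rw [show m + 1 + k - m = k + 1 by omega] at *
        linear_combination X ^ (m+2) * b1 + b2 - a1 - X ^ (k+1) * a2

theorem qz_neg (n : ℕ) (m : ℤ) (h : m < 0) : qbinomZ n m = 0 := by
  rw [qbinomZ, if_neg (by omega)]

theorem qz_gt (n : ℕ) (m : ℤ) (h : n < m) : qbinomZ n m = 0 := by
  rw [qbinomZ, if_pos (by omega), qb_gt _ _ (by omega)]

theorem qz_nat (n m : ℕ) : qbinomZ n (m : ℤ) = qbinom n m := by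
  rw [qbinomZ, if_pos (by omega)]; simp

theorem qz_p1 (n : ℕ) (m : ℤ) :
    qbinomZ (n+1) m = X ^ m.toNat * qbinomZ n m + qbinomZ n (m-1) := by
  rcases lt_or_ge m 0 with h | h
  · rw [qz_neg _ _ h, qz_neg _ _ h, qz_neg _ _ (by omega)]; simp
  obtain ⟨k, rfl⟩ := Int.eq_ofNat_of_zero_le h
  rcases k with _ | k
  · rw [qz_neg n (((0:ℕ):ℤ) - 1) (by simp), qz_nat, qz_nat, qb_zero_right, qb_zero_right]; simp
  · rw [show ((k+1 : ℕ) : ℤ) - 1 = (k : ℕ) by push_cast; ring, qz_nat, qz_nat, qz_nat, qb_ss]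
    simp only [Int.toNat_natCast]

theorem qz_p2 (n : ℕ) (m : ℤ) :
    qbinomZ (n+1) m = qbinomZ n m + X ^ ((n : ℤ) + 1 - m).toNat * qbinomZ n (m-1) := by
  rcases lt_or_ge m 0 with h | h
  · rw [qz_neg _ _ h, qz_neg _ _ h, qz_neg _ _ (by omega)]; simp
  obtain ⟨k, rfl⟩ := Int.eq_ofNat_of_zero_le h
  rcases k with _ | k
  · rw [qz_neg n (((0:ℕ):ℤ) - 1) (by simp), qz_nat, qz_nat, qb_zero_right, qb_zero_right]; simp
  · rw [show ((k+1 : ℕ) : ℤ) - 1 = (k : ℕ) by push_cast; ring, qz_nat, qz_nat, qz_nat, qb_ss2]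
    rw [show ((n : ℤ) + 1 - ((k+1 : ℕ) : ℤ)).toNat = n - k by omega]

theorem e_nonneg (j : ℤ) : 0 ≤ j * (5 * j + 1) / 2 := by
  apply Int.ediv_nonneg _ (by norm_num)
  rcases lt_or_ge j 0 with h | h
  · exact mul_nonneg_of_nonpos_of_nonpos h.le (by omega)
  · positivity

theorem e_succ (j : ℤ) : (j+1) * (5 * (j+1) + 1) / 2 = j * (5 * j + 1) / 2 + (5 * j + 3) := by
  rw [show (j+1) * (5 * (j+1) + 1) = j * (5 * j + 1) + (5 * j + 3) * 2 by ring]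
  exact Int.add_mul_ediv_right _ _ (by norm_num)

noncomputable def qT (n : ℕ) (j : ℤ) : Polynomial ℤ :=
  C ((j.negOnePow : ℤˣ) : ℤ) * X ^ (j * (5 * j + 1) / 2).toNat *
          qbinomZ n (((n : ℤ) - 5 * j) / 2)

noncomputable def qG (n : ℕ) (j : ℤ) : Polynomial ℤ :=
  if ((n : ℤ) + 2 - 5 * j) % 2 = 0 then
  C ((j.negOnePow : ℤˣ) : ℤ) * X ^ (j * (5 * j + 1) / 2).toNat *
    (X ^ (((n : ℤ) + 2 - 5 * j) / 2).toNat * qbinomZ n (((n : ℤ) + 2 - 5 * j) / 2)) else 0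

theorem qz_supp (n : ℕ) (f : ℤ → Polynomial ℤ) (h : ∀ j : ℤ, (j < -(n:ℤ) - 2 ∨ (n : ℤ) + 2 < j) → f j = 0) :
    f.support.Finite := by
  apply (Set.finite_Icc (-(n:ℤ) - 2) (n + 2)).subset
  intro j hj
  by_contra hc
  apply hj
  apply h
  rw [Set.mem_Icc] at hc
  omega

theorem qT_supp (n : ℕ) : (qT n).support.Finite := by
  apply qz_supp n
  intro j hj
  rw [qT]
  rcases hj with hj | hj
  · rw [qz_gt _ _ (by omega), mul_zero]
  · rw [qz_neg _ _ (by omega), mul_zero]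

theorem qG_supp (n : ℕ) : (qG n).support.Finite := by
  apply qz_supp n
  intro j hj
  rw [qG]
  rcases hj with hj | hj
  · rw [qz_gt _ _ (by omega)]; simp
  · rw [qz_neg _ _ (by omega)]; simp

theorem qz_pow (n : ℕ) (m a b : ℤ) (P : Polynomial ℤ) (c d : ℕ)
    (h : 0 ≤ m → m ≤ n → a.toNat + b.toNat = c + d) :
    X ^ a.toNat * (X ^ b.toNat * (P * qbinomZ n m)) = X ^ c * (X ^ d * (P * qbinomZ n m)) := by
  rcases lt_or_ge m 0 with h1 | h1
  · rw [qz_neg _ _ h1]; simp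
  rcases lt_or_ge (n : ℤ) m with h2 | h2
  · rw [qz_gt _ _ h2]; simp
  rw [← mul_assoc, ← mul_assoc (X ^ c), ← pow_add, ← pow_add, h h1 h2]

theorem qT_rec (n : ℕ) (j : ℤ) :
    qT (n+2) j + qG n (j+1) = qT (n+1) j + X ^ (n+1) * qT n j + qG n j := by
  have he := e_nonneg j
  have he1 := e_nonneg (j+1)
  rw [e_succ] at he1
  rcases Int.emod_two_eq_zero_or_one ((n : ℤ) + 2 - 5 * j) with hp | hp
  · -- B
    obtain ⟨m, hm⟩ : ∃ m, (n : ℤ) + 2 - 5 * j = 2 * m := ⟨_, (by omega : _ = 2 * (((n : ℤ) + 2 - 5 * j) / 2))⟩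
    rw [qT, qT, qT, qG, qG, if_pos hp, if_neg (by omega)]
    push_cast
    rw [show ((n : ℤ) + 2 - 5 * j) / 2 = m by omega, show ((n : ℤ) + 1 - 5 * j) / 2 = m - 1 by omega,
      show ((n : ℤ) - 5 * j) / 2 = m - 1 by omega]
    have h1 := qz_p1 (n+1) m
    have h2 := qz_p2 n m
    have h3 := qz_pow n (m-1) m (n + 1 - m) 1 (n+1) 0 (by intros; omega)
    generalize (X : Polynomial ℤ) ^ (j * (5 * j + 1) / 2).toNat = E at *
    simp only [pow_zero, one_mul] at h3
    linear_combination C ((j.negOnePow : ℤˣ) : ℤ) * E * (h1 + X ^ m.toNat * h2 + h3)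
  · -- A
    obtain ⟨m, hm⟩ : ∃ m, (n : ℤ) + 1 - 5 * j = 2 * m := ⟨_, (by omega : _ = 2 * (((n : ℤ) + 1 - 5 * j) / 2))⟩
    rw [qT, qT, qT, qG, qG, if_pos (by omega), if_neg (by omega), e_succ, Int.negOnePow_succ]
    push_cast
    rw [show ((n : ℤ) + 2 - 5 * j) / 2 = m by omega, show ((n : ℤ) + 1 - 5 * j) / 2 = m by omega,
      show ((n : ℤ) - 5 * j) / 2 = m - 1 by omega, show ((n : ℤ) + 2 - 5 * (j + 1)) / 2 = m - 2 by omega]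
    have h1 := qz_p2 (n+1) m
    have h2 := qz_p1 n (m-1)
    rw [show m - 1 - 1 = m - 2 by ring] at h2
    have h3 := qz_pow n (m-1) (n + 2 - m) (m-1) 1 (n+1) 0 (by intros; omega)
    have h4 := qz_pow n (m-2) (j * (5 * j + 1) / 2 + (5 * j + 3)) (m-2) 1
      (j * (5 * j + 1) / 2).toNat (n + 2 - m : ℤ).toNat (by intros; omega)
    push_cast at h1
    rw [show (n : ℤ) + 1 + 1 - m = n + 2 - m by ring] at h1
    simp only [pow_zero, one_mul] at h3 h4
    generalize (X : Polynomial ℤ) ^ (j * (5 * j + 1) / 2).toNat = E at *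
    simp only [map_neg]
    linear_combination C ((j.negOnePow : ℤˣ) : ℤ) * (E * (h1 + X ^ (n + 2 - m : ℤ).toNat * h2 + h3) - h4)

theorem qS_rec (n : ℕ) :
    ∑ᶠ j, qT (n+2) j = ∑ᶠ j, qT (n+1) j + X ^ (n+1) * ∑ᶠ j, qT n j := by
  have hs : ∑ᶠ j, qG n (j+1) = ∑ᶠ j, qG n j :=
    finsum_comp_equiv (Equiv.addRight (1 : ℤ)) (f := qG n)
  have hG1 : (fun j => qG n (j+1)).support.Finite := by
    apply qz_supp n
    intro j hj
    simp only [qG]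
    rcases hj with hj | hj
    · rw [qz_gt _ _ (by omega)]; simp
    · rw [qz_neg _ _ (by omega)]; simp
  have hX : (fun j => X ^ (n+1) * qT n j).support.Finite :=
    (qT_supp n).subset (Function.support_mul_subset_right _ _)
  have h := finsum_congr (qT_rec n)
  rw [finsum_add_distrib (qT_supp _) hG1,
    finsum_add_distrib (((qT_supp (n+1)).union hX).subset (Function.support_add _ _)) (qG_supp n),
    finsum_add_distrib (qT_supp _) hX, hs, ← mul_finsum] at h
  exact add_right_cancel h

theorem qS_base (n : ℕ) (h : n < 2) : ∑ᶠ j, qT n j = 1 := by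
  rw [finsum_eq_single _ 0]
  · rw [qT, show ((n : ℤ) - 5 * 0) / 2 = (0 : ℕ) by omega, qz_nat, qb_zero_right]; simp
  · intro j hj
    rw [qT]
    rcases lt_or_ge j 0 with hj | hj
    · rw [qz_gt _ _ (by omega), mul_zero]
    · rw [qz_neg _ _ (by omega), mul_zero]

theorem qF_eq (n : ℕ) : qF (n+1) = ∑ᶠ j, qT n j := by
  induction n using Nat.strong_induction_on with
  | _ n ih =>
    rcases n with _ | _ | n
    · rw [qS_base 0 (by omega)]; simp [qF]
    · rw [qS_base 1 (by omega)]; simp [qF]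
    · rw [qS_rec, ← ih (n+1) (by omega), ← ih n (by omega)]
      rw [qF]

/-- For n ≥ 0, j(5j+1)/2 ≥ 0 for all j ∈ ℤ and
F_{n+1}(q) = Σ_{j ∈ ℤ} (−1)^j q^(j(5j+1)/2) [n choose ⌊(n−5j)/2⌋]_q,
the sum having finitely many nonzero terms. -/
theorem qFib_alternating_sum_formula (n : ℕ) :
    (∀ j : ℤ, 0 ≤ j * (5 * j + 1) / 2) ∧
      qF (n + 1) = ∑ᶠ j : ℤ,
        C ((j.negOnePow : ℤˣ) : ℤ) * X ^ (j * (5 * j + 1) / 2).toNat *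
          qbinomZ n (((n : ℤ) - 5 * j) / 2) := by
  exact ⟨e_nonneg, qF_eq n⟩
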